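/- Let G be a finite group, p a prime, and suppose G has exactly one noncentral conjugacy class a^G of p-regular elements (elements of order coprime to p), with a noncentral. Then |π(G)| ≤ 2, i.e., the order of G is divisible by at most two primes, and G is soluble. -/

import Mathlib

/-- If the average of finitely many roots of unity is a nonzero algebraic integer, then these roots
of unity are all equal. -/
theorem exists_eq_of_isIntegral_average_rootsOfUnity {ι : Type*} [Fintype ι] {m : ℕ} (hm : 0 < m)
    (z : ι → ℂ) (hz : ∀ i, z i ^ m = 1)
    (hint : IsIntegral ℤ ((∑ i, z i) / Fintype.card ι)) (hsum : ∑ i, z i ≠ 0) :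
    ∃ μ, ∀ i, z i = μ := by
  have hcard : (0 : ℝ) < Fintype.card ι := by
    rw [Nat.cast_pos, Fintype.card_pos_iff]
    by_contra h
    rw [not_nonempty_iff] at h
    simp at hsum
  have hcardC : (Fintype.card ι : ℂ) ≠ 0 := by exact_mod_cast hcard.ne'
  set α := (∑ i, z i) / Fintype.card ι with hα
  let K := IntermediateField.adjoin ℚ (Set.range z)
  have hzint (i) : IsIntegral ℚ (z i) := IsIntegral.of_pow hm (by rw [hz]; exact isIntegral_one)
  have : FiniteDimensional ℚ K := IntermediateField.finiteDimensional_adjoin (by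
    rintro _ ⟨i, rfl⟩; exact hzint i)
  have : NumberField K := ⟨⟩
  let w : ι → K := fun i ↦ ⟨z i, IntermediateField.subset_adjoin ℚ _ ⟨i, rfl⟩⟩
  have hw (i) : w i ^ m = 1 := Subtype.ext (hz i)
  let β : K := (∑ i, w i) / Fintype.card ι
  have hβ : (β : ℂ) = α := by
    change algebraMap K ℂ ((∑ i, w i) / Fintype.card ι) = _
    rw [map_div₀, map_sum, map_natCast]
    rfl
  have hα0 : α ≠ 0 := div_ne_zero hsum hcardC
  obtain ⟨n, hn, hβn⟩ := NumberField.Embeddings.pow_eq_one_of_norm_le_one K ℂ (x := β)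
    (fun h ↦ hα0 (by rw [← hβ, h]; rfl))
    ((isIntegral_algebraMap_iff (algebraMap K ℂ).injective).mp (by
      change IsIntegral ℤ (β : ℂ)
      rwa [hβ])) (fun φ ↦ by
      simp only [β, map_div₀, map_sum, map_natCast, norm_div, Complex.norm_natCast]
      rw [div_le_one hcard]
      refine (norm_sum_le _ _).trans_eq ?_
      have h1 (i : ι) : ‖φ (w i)‖ = 1 :=
        Complex.norm_eq_one_of_pow_eq_one (by rw [← map_pow, hw, map_one]) hm.ne'
      simp [h1])
  have hαn : ‖α‖ = 1 := Complex.norm_eq_one_of_pow_eq_one (n := n) (by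
    rw [← hβ]
    exact congrArg (algebraMap K ℂ) hβn) hn.ne'
  have hsumα : ∑ i, z i = Fintype.card ι * α := by rw [hα]; field_simp
  have hzn (i) : ‖z i‖ = 1 := Complex.norm_eq_one_of_pow_eq_one (hz i) hm.ne'
  have hre (i) : (starRingEnd ℂ α * z i).re ≤ 1 := (Complex.re_le_norm _).trans_eq (by
    simp [hαn, hzn])
  have htot : ∑ i, (starRingEnd ℂ α * z i).re = ∑ _i : ι, (1 : ℝ) := by
    rw [← Complex.re_sum, ← Finset.mul_sum, hsumα, mul_left_comm, ← Complex.normSq_eq_conj_mul_self,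
      Complex.normSq_eq_norm_sq, hαn]
    simp
  refine ⟨α, fun i ↦ ?_⟩
  have h1 := (Finset.sum_eq_sum_iff_of_le fun i _ ↦ hre i).mp htot i (Finset.mem_univ i)
  have h2 : starRingEnd ℂ α * z i = 1 := by
    have hn1 : ‖starRingEnd ℂ α * z i‖ = 1 := by simp [hαn, hzn]
    have := Complex.sq_norm (starRingEnd ℂ α * z i)
    rw [Complex.normSq_apply, hn1, h1] at this
    refine Complex.ext h1 ?_
    rw [Complex.one_im]
    nlinarith
  have h3 : starRingEnd ℂ α * α = 1 := by
    rw [← Complex.normSq_eq_conj_mul_self, Complex.normSq_eq_norm_sq, hαn]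
    simp
  exact mul_left_cancel₀ (left_ne_zero_of_mul_eq_one h3) (h2.trans h3.symm)

theorem Matrix.pow_eq_one_of_mem_roots_charpoly {n : Type*} [Fintype n] [DecidableEq n] {m : ℕ}
    {M : Matrix n n ℂ} (hM : M ^ m = 1) {z : ℂ} (hz : z ∈ M.charpoly.roots) : z ^ m = 1 := by
  have h := spectrum.pow_mem_pow M m
    (Matrix.mem_spectrum_iff_isRoot_charpoly.mpr (Polynomial.isRoot_of_mem_roots hz))
  rw [hM] at h
  have : Nontrivial (Matrix n n ℂ) := by
    by_contra hn
    rw [not_nontrivial_iff_subsingleton] at hn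
    simp [spectrum.of_subsingleton] at h
  simpa using h

theorem Matrix.isIntegral_trace_of_pow_eq_one {n : Type*} [Fintype n] [DecidableEq n] {m : ℕ}
    (hm : 0 < m) {M : Matrix n n ℂ} (hM : M ^ m = 1) : IsIntegral ℤ M.trace := by
  rw [Matrix.trace_eq_sum_roots_charpoly]
  refine IsIntegral.multiset_sum fun z hz ↦ IsIntegral.of_pow hm ?_
  rw [Matrix.pow_eq_one_of_mem_roots_charpoly hM hz]
  exact isIntegral_one

/-- A complex matrix of finite order whose normalized trace is a nonzero algebraic integer is
scalar. -/
theorem Matrix.exists_eq_scalar_of_isIntegral_trace_div {n : Type*} [Fintype n] [DecidableEq n]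
    {m : ℕ} (hm : 0 < m) {M : Matrix n n ℂ} (hM : M ^ m = 1)
    (hint : IsIntegral ℤ (M.trace / Fintype.card n)) (htr : M.trace ≠ 0) :
    ∃ μ, M = Matrix.scalar n μ := by
  obtain ⟨l, hl⟩ : ∃ l : List ℂ, M.charpoly.roots = l := ⟨_, (Multiset.coe_toList _).symm⟩
  have hmem (z) (hz : z ∈ l) : z ^ m = 1 :=
    Matrix.pow_eq_one_of_mem_roots_charpoly hM (by rw [hl]; exact hz)
  have hsum : M.trace = ∑ i : Fin l.length, l.get i := by
    rw [Matrix.trace_eq_sum_roots_charpoly, hl, Multiset.sum_coe]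
    simp
  have hsplit := IsAlgClosed.splits M.charpoly
  have hlen : Fintype.card (Fin l.length) = Fintype.card n := by
    rw [Fintype.card_fin, ← Multiset.coe_card, ← hl, ← hsplit.natDegree_eq_card_roots,
      Matrix.charpoly_natDegree_eq_dim]
  obtain ⟨μ, hμ⟩ := exists_eq_of_isIntegral_average_rootsOfUnity hm (fun i ↦ l.get i)
    (fun i ↦ hmem _ (l.get_mem i)) (by rwa [hlen, ← hsum]) (by rwa [← hsum])
  have hroots : M.charpoly.roots = Multiset.replicate (Fintype.card n) μ := by
    rw [Multiset.eq_replicate, ← hlen, hl]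
    refine ⟨by simp, fun z hz ↦ ?_⟩
    obtain ⟨i, rfl⟩ := List.mem_iff_get.mp (Multiset.mem_coe.mp hz)
    exact hμ i
  have hcharpoly : M.charpoly = (Polynomial.X - Polynomial.C μ) ^ Fintype.card n := by
    rw [hsplit.eq_prod_roots_of_monic M.charpoly_monic, hroots]
    simp
  have hsq : Squarefree (minpoly ℂ M) := by
    refine Squarefree.squarefree_of_dvd (minpoly.dvd ℂ M (p := Polynomial.X ^ m - 1) (by simp [hM]))
      (Polynomial.Separable.squarefree ?_)
    exact Polynomial.separable_X_pow_sub_C 1 (by exact_mod_cast hm.ne') one_ne_zero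
  have hn : Fintype.card n ≠ 0 := by
    intro h
    have := Fintype.card_eq_zero_iff.mp h
    simp [Matrix.trace] at htr
  have hdvd : minpoly ℂ M ∣ Polynomial.X - Polynomial.C μ := by
    rw [← hsq.dvd_pow_iff_dvd hn, ← hcharpoly]
    exact M.minpoly_dvd_charpoly
  refine ⟨μ, ?_⟩
  have := (minpoly.dvd_iff).mp hdvd
  simpa [sub_eq_zero, Matrix.algebraMap_eq_diagonal, Pi.algebraMap_def] using this

theorem Matrix.trace_mulLeft_pi {ι R : Type*} [Fintype ι] [DecidableEq ι] [CommRing R] {d : ι → ℕ}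
    (a : Π i, Matrix (Fin (d i)) (Fin (d i)) R) :
    LinearMap.trace R _ (LinearMap.mulLeft R a) = ∑ i, d i * (a i).trace := by
  rw [LinearMap.trace_eq_matrix_trace R (Pi.basis fun i ↦ Matrix.stdBasis R (Fin (d i)) (Fin (d i))),
    Matrix.trace, Fintype.sum_sigma]
  refine Finset.sum_congr rfl fun i _ ↦ ?_
  rw [Fintype.sum_prod_type, Matrix.trace, Finset.mul_sum]
  refine Finset.sum_congr rfl fun j _ ↦ ?_
  have hentry (k : Fin (d i)) : Matrix.diag (LinearMap.toMatrix
      (Pi.basis fun i ↦ Matrix.stdBasis R (Fin (d i)) (Fin (d i)))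
      (Pi.basis fun i ↦ Matrix.stdBasis R (Fin (d i)) (Fin (d i)))
      (LinearMap.mulLeft R a)) ⟨i, j, k⟩ = a i j j := by
    rw [Matrix.diag_apply, LinearMap.toMatrix_apply, Pi.basis_repr, Pi.basis_apply,
      Matrix.stdBasis_eq_single]
    simp [Matrix.stdBasis]
  rw [Finset.sum_congr rfl fun k _ ↦ hentry k]
  simp

theorem MonoidAlgebra.trace_mulLeft_single {G R : Type*} [Group G] [Finite G] [CommRing R] {g : G}
    (hg : g ≠ 1) : LinearMap.trace R _ (LinearMap.mulLeft R (MonoidAlgebra.single g (1 : R))) = 0 := by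
  classical
  have := Fintype.ofFinite G
  rw [LinearMap.trace_eq_matrix_trace R (MonoidAlgebra.basis G R), Matrix.trace]
  refine Finset.sum_eq_zero fun h _ ↦ ?_
  rw [Matrix.diag_apply, LinearMap.toMatrix_apply, MonoidAlgebra.basis_apply]
  simp [MonoidAlgebra.basis, hg]

/-- The matrix representations of a finite group obtained from the Wedderburn decomposition of its
complex group algebra. -/
theorem MonoidAlgebra.exists_matrix_representations (G : Type*) [Group G] [Finite G] :
    ∃ (n : ℕ) (d : Fin n → ℕ) (ρ : Π i, G →* Matrix (Fin (d i)) (Fin (d i)) ℂ),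
      (∀ i, d i ≠ 0) ∧
      (∀ g : G, g ≠ 1 → ∑ i, d i * (ρ i g).trace = 0) ∧
      (∀ i M, (∀ g, Commute M (ρ i g)) → ∃ μ, M = Matrix.scalar _ μ) ∧
      ∃ i₀, d i₀ = 1 ∧ ∀ i, (∀ g, ρ i g = 1) ↔ i = i₀ := by
  have := Fintype.ofFinite G
  have : Module.Finite ℂ (MonoidAlgebra ℂ G) := Module.Finite.of_basis (MonoidAlgebra.basis G ℂ)
  have : IsSemisimpleRing (MonoidAlgebra ℂ G) := inferInstance
  obtain ⟨n, d, hd, ⟨e⟩⟩ :=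
    IsSemisimpleRing.exists_algEquiv_pi_matrix_of_isAlgClosed ℂ (MonoidAlgebra ℂ G)
  let ρ (i : Fin n) : G →* Matrix (Fin (d i)) (Fin (d i)) ℂ :=
    ((Pi.evalMonoidHom (fun i ↦ Matrix (Fin (d i)) (Fin (d i)) ℂ) i).comp
      (e : MonoidAlgebra ℂ G →* _)).comp (MonoidAlgebra.of ℂ G)
  have hρ (i g) : ρ i g = e (MonoidAlgebra.single g 1) i := rfl
  have hlin {V : Type} [AddCommGroup V] [Module ℂ V]
      (f f' : (Π i, Matrix (Fin (d i)) (Fin (d i)) ℂ) →ₗ[ℂ] V)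
      (h : ∀ g : G, f (fun i ↦ ρ i g) = f' (fun i ↦ ρ i g)) : f = f' := by
    have : f ∘ₗ e.toLinearMap = f' ∘ₗ e.toLinearMap :=
      (MonoidAlgebra.basis G ℂ).ext fun g ↦ by
        rw [MonoidAlgebra.basis_apply]
        exact h g
    refine LinearMap.ext fun x ↦ ?_
    simpa using LinearMap.congr_fun this (e.symm x)
  have hcomm (i M) (hM : ∀ g, Commute M (ρ i g)) : ∃ μ, M = Matrix.scalar _ μ := by
    have h := hlin (LinearMap.mulLeft ℂ M ∘ₗ LinearMap.proj i)
      (LinearMap.mulRight ℂ M ∘ₗ LinearMap.proj i) (fun g ↦ hM g)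
    have hc : M ∈ Set.center (Matrix (Fin (d i)) (Fin (d i)) ℂ) := by
      rw [Semigroup.mem_center_iff]
      intro N
      simpa using (LinearMap.congr_fun h (Pi.single i N)).symm
    rw [Matrix.center_eq_range] at hc
    obtain ⟨μ, rfl⟩ := hc
    exact ⟨μ, rfl⟩
  have hone (i) (hi : ∀ g, ρ i g = 1) : d i = 1 := by
    by_contra hdi
    have h0 := (hd i).out
    let a : Fin (d i) := ⟨0, by lia⟩
    let b : Fin (d i) := ⟨1, by lia⟩
    have hab : a ≠ b := by simp [a, b]
    have h := hlin (Matrix.entryLinearMap ℂ ℂ a b ∘ₗ LinearMap.proj i) 0 (fun g ↦ by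
      simp [hi, hab])
    simpa using LinearMap.congr_fun h (Pi.single i (Matrix.single a b 1))
  have huniq (i j) (hi : ∀ g, ρ i g = 1) (hj : ∀ g, ρ j g = 1) : i = j := by
    by_contra hij
    let a : Fin (d i) := ⟨0, Nat.pos_of_ne_zero (hd i).out⟩
    let b : Fin (d j) := ⟨0, Nat.pos_of_ne_zero (hd j).out⟩
    have h := hlin (Matrix.entryLinearMap ℂ ℂ a a ∘ₗ LinearMap.proj i)
      (Matrix.entryLinearMap ℂ ℂ b b ∘ₗ LinearMap.proj j) (fun g ↦ by simp [hi, hj])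
    simpa [Ne.symm hij] using LinearMap.congr_fun h (Pi.single i (Matrix.single a a 1))
  have hex : ∃ i, ∀ g, ρ i g = 1 := by
    let s : MonoidAlgebra ℂ G := ∑ g, MonoidAlgebra.single g 1
    have hsl (g : G) : MonoidAlgebra.single g 1 * s = s := by
      simp only [s, Finset.mul_sum, MonoidAlgebra.single_mul_single, mul_one]
      exact Fintype.sum_equiv (Equiv.mulLeft g) _ _ fun _ ↦ rfl
    have hsr (g : G) : s * MonoidAlgebra.single g 1 = s := by
      simp only [s, Finset.sum_mul, MonoidAlgebra.single_mul_single, mul_one]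
      exact Fintype.sum_equiv (Equiv.mulRight g) _ _ fun _ ↦ rfl
    have hs : s ≠ 0 := by
      intro h
      have := congrArg (MonoidAlgebra.lift ℂ ℂ G 1) h
      simp [s] at this
    have hes : e s ≠ 0 := by simpa using hs
    obtain ⟨i, hi⟩ := Function.ne_iff.mp hes
    have hl (g : G) : ρ i g * e s i = e s i := by
      rw [hρ, ← Pi.mul_apply, ← map_mul, hsl]
    have hr (g : G) : e s i * ρ i g = e s i := by
      rw [hρ, ← Pi.mul_apply, ← map_mul, hsr]
    obtain ⟨μ, hμ⟩ := hcomm i (e s i) fun g ↦ (hr g).trans (hl g).symm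
    have hμ0 : μ ≠ 0 := by
      rintro rfl
      exact hi (by simpa using hμ)
    refine ⟨i, fun g ↦ ?_⟩
    have h := hl g
    rw [hμ, Matrix.scalar_apply, ← Matrix.smul_one_eq_diagonal, mul_smul_comm, mul_one] at h
    exact smul_right_injective _ hμ0 h
  obtain ⟨i₀, hi₀⟩ := hex
  refine ⟨n, d, ρ, fun i ↦ (hd i).out, fun g hg ↦ ?_, hcomm, i₀, hone i₀ hi₀,
    fun i ↦ ⟨fun hi ↦ huniq i i₀ hi hi₀, fun hi ↦ hi ▸ hi₀⟩⟩
  rw [← MonoidAlgebra.trace_mulLeft_single (R := ℂ) hg, ← LinearMap.trace_conj' _ e.toLinearEquiv]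
  rw [← Matrix.trace_mulLeft_pi]
  congr 1
  refine LinearMap.ext fun x ↦ ?_
  have h := (map_mul e (MonoidAlgebra.single g 1) (e.symm x)).symm
  rw [e.apply_symm_apply] at h
  exact h

/-- Class sums act by algebraic integers: if all matrices commuting with the image of a
representation are scalar, then `|C| * χ(g) / χ(1)` is an algebraic integer, where `C` is the
conjugacy class of `g`. -/
theorem Matrix.isIntegral_card_mul_trace_div {G : Type*} [Group G] [Finite G] {d : ℕ} (hd : d ≠ 0)
    (ρ : G →* Matrix (Fin d) (Fin d) ℂ)
    (hρ : ∀ M, (∀ g, Commute M (ρ g)) → ∃ μ, M = Matrix.scalar _ μ) (g : G) :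
    IsIntegral ℤ ((Nat.card (ConjClasses.mk g).carrier : ℂ) * (ρ g).trace / d) := by
  classical
  have := Fintype.ofFinite G
  have : Module.Finite ℤ (MonoidAlgebra ℤ G) := Module.Finite.of_basis (MonoidAlgebra.basis G ℤ)
  have : NeZero d := ⟨hd⟩
  let C : Finset G := (ConjClasses.mk g).carrier.toFinset
  have hC (x : G) : x ∈ C ↔ IsConj g x := by
    rw [Set.mem_toFinset, ConjClasses.mem_carrier_iff_mk_eq, ConjClasses.mk_eq_mk_iff_isConj,
      isConj_comm]
  have hint : IsIntegral ℤ (∑ x ∈ C, ρ x) := by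
    have h : ∑ x ∈ C, ρ x =
        MonoidAlgebra.lift ℤ (Matrix (Fin d) (Fin d) ℂ) G ρ (∑ x ∈ C, MonoidAlgebra.single x 1) := by
      simp
    rw [h]
    exact (IsIntegral.of_finite ℤ _).map _
  obtain ⟨μ, hμ⟩ := hρ (∑ x ∈ C, ρ x) fun h ↦ by
    rw [Commute, SemiconjBy, Finset.sum_mul, Finset.mul_sum]
    refine Finset.sum_bij' (fun x _ ↦ h⁻¹ * x * h) (fun x _ ↦ h * x * h⁻¹) ?_ ?_ ?_ ?_ ?_
    · intro x hx
      rw [hC] at hx ⊢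
      exact hx.trans (isConj_iff.mpr ⟨h⁻¹, by group⟩)
    · intro x hx
      rw [hC] at hx ⊢
      exact hx.trans (isConj_iff.mpr ⟨h, by group⟩)
    · intros; group
    · intros; group
    · intro x _
      rw [← map_mul, ← map_mul]
      congr 1
      group
  have hμint : IsIntegral ℤ μ := by
    rw [hμ] at hint
    exact (isIntegral_algHom_iff ((Matrix.scalarAlgHom (Fin d) ℂ).restrictScalars ℤ)
      fun _ _ h ↦ Matrix.scalar_inj.mp h).mp hint
  have htr : (C.card : ℂ) * (ρ g).trace = d * μ := by
    have h := congrArg Matrix.trace hμ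
    rw [Matrix.trace_sum, Finset.sum_congr rfl (g := fun _ ↦ (ρ g).trace)] at h
    · simpa using h
    · intro x hx
      obtain ⟨c, rfl⟩ := isConj_iff.mp ((hC x).mp hx)
      rw [map_mul, map_mul, Matrix.trace_mul_comm, ← mul_assoc, ← map_mul, inv_mul_cancel, map_one,
        one_mul]
  have hcard : Nat.card (ConjClasses.mk g).carrier = C.card := by
    rw [Nat.card_eq_fintype_card, Set.toFinset_card]
  rw [hcard, htr, mul_div_cancel_left₀ _ (by exact_mod_cast hd)]
  exact hμint

/-- **Burnside's theorem on conjugacy classes of prime power size**: in a finite simple group with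
trivial center, the class of a nontrivial element does not have prime power size. -/
theorem IsSimpleGroup.card_conjClass_ne_prime_pow {G : Type*} [Group G] [Finite G] [IsSimpleGroup G]
    (hG : Subgroup.center G = ⊥) {g : G} (hg : g ≠ 1) {p : ℕ} (hp : p.Prime) (k : ℕ) :
    Nat.card (ConjClasses.mk g).carrier ≠ p ^ k := by
  intro hcard
  obtain ⟨n, d, ρ, hd, htr, hcomm, i₀, hdi₀, hi₀⟩ := MonoidAlgebra.exists_matrix_representations G
  have hpow (i) : ρ i g ^ Nat.card G = 1 := by rw [← map_pow, pow_card_eq_one', map_one]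
  have hχ (i) : IsIntegral ℤ (ρ i g).trace :=
    Matrix.isIntegral_trace_of_pow_eq_one Nat.card_pos (hpow i)
  have hzero (i) (hi : i ≠ i₀) (hpi : ¬ p ∣ d i) : (ρ i g).trace = 0 := by
    by_contra htr0
    have hdC : (d i : ℂ) ≠ 0 := by exact_mod_cast hd i
    have hcop : IsCoprime ((p ^ k : ℕ) : ℤ) (d i : ℤ) :=
      Nat.isCoprime_iff_coprime.mpr (((Nat.Prime.coprime_iff_not_dvd hp).mpr hpi).pow_left k)
    obtain ⟨u, v, huv⟩ := hcop
    have hint : IsIntegral ℤ ((ρ i g).trace / d i) := by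
      have h1 := Matrix.isIntegral_card_mul_trace_div (hd i) (ρ i) (hcomm i) g
      rw [hcard] at h1
      have h2 : (ρ i g).trace / d i = algebraMap ℤ ℂ u * (((p ^ k : ℕ) : ℂ) * (ρ i g).trace / d i)
          + algebraMap ℤ ℂ v * (ρ i g).trace := by
        have huvC : (u : ℂ) * ((p ^ k : ℕ) : ℂ) + v * d i = 1 := by exact_mod_cast huv
        simp only [algebraMap_int_eq, eq_intCast]
        field_simp
        linear_combination -huvC
      rw [h2]
      exact (isIntegral_algebraMap.mul h1).add (isIntegral_algebraMap.mul (hχ i))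
    obtain ⟨μ, hμ⟩ := Matrix.exists_eq_scalar_of_isIntegral_trace_div Nat.card_pos (hpow i)
      (by rwa [Fintype.card_fin]) htr0
    have hker : (ρ i).ker = ⊥ := by
      refine (IsSimpleGroup.eq_bot_or_eq_top_of_normal (ρ i).ker inferInstance).resolve_right ?_
      intro h
      refine hi ((hi₀ i).mp fun x ↦ ?_)
      rw [← MonoidHom.mem_ker, h]
      trivial
    have hinj : Function.Injective (ρ i) := (MonoidHom.ker_eq_bot_iff _).mp hker
    refine hg ?_
    rw [← Subgroup.mem_bot, ← hG, Subgroup.mem_center_iff]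
    intro x
    apply hinj
    rw [map_mul, map_mul, hμ]
    exact ((Matrix.scalar_commute μ (fun _ ↦ Commute.all _ _) (ρ i x)).eq).symm
  have hsum := htr g hg
  rw [← Finset.add_sum_erase _ _ (Finset.mem_univ i₀), (hi₀ i₀).mpr rfl] at hsum
  have hterm (i) (hi : i ∈ Finset.univ.erase i₀) :
      d i * (ρ i g).trace = p * ((d i / p : ℕ) * (ρ i g).trace) := by
    by_cases hpi : p ∣ d i
    · rw [← mul_assoc, ← Nat.cast_mul, Nat.mul_div_cancel' hpi]
    · simp [hzero i (Finset.ne_of_mem_erase hi) hpi]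
  rw [Finset.sum_congr rfl hterm, ← Finset.mul_sum] at hsum
  set S := ∑ i ∈ Finset.univ.erase i₀, ((d i / p : ℕ) : ℂ) * (ρ i g).trace with hS
  have hSint : IsIntegral ℤ S := IsIntegral.sum _ fun i _ ↦ (isIntegral_natCast _).mul (hχ i)
  have hpC : (p : ℂ) ≠ 0 := by exact_mod_cast hp.ne_zero
  have hSp : -S = algebraMap ℚ ℂ (1 / p) := by
    have h1 : (1 : ℂ) + p * S = 0 := by simpa [hdi₀] using hsum
    rw [map_div₀, map_one, map_natCast, eq_div_iff hpC]
    linear_combination -h1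
  have hq : IsIntegral ℤ (1 / p : ℚ) :=
    (isIntegral_algebraMap_iff (algebraMap ℚ ℂ).injective).mp (hSp ▸ hSint.neg)
  obtain ⟨z, hz⟩ := IsIntegrallyClosed.isIntegral_iff.mp hq
  have hpQ : (p : ℚ) ≠ 0 := by exact_mod_cast hp.ne_zero
  rw [eq_div_iff hpQ] at hz
  have hz' : z * p = 1 := by
    rw [algebraMap_int_eq, eq_intCast] at hz
    exact_mod_cast hz
  exact hp.one_lt.ne' (by exact_mod_cast Int.eq_one_of_mul_eq_one_left (by positivity) hz')

/-- **Burnside's `p^a q^b` theorem**. -/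
theorem Group.isSolvable_of_card_primeFactors_le_two (G : Type*) [Group G] [Finite G]
    (h : (Nat.card G).primeFactors.card ≤ 2) : Group.IsSolvable G := by
  induction hn : Nat.card G using Nat.strong_induction_on generalizing G with
  | _ n ih =>
  subst hn
  by_cases hnormal : ∃ N : Subgroup G, N.Normal ∧ N ≠ ⊥ ∧ N ≠ ⊤
  · obtain ⟨N, hN, hbot, htop⟩ := hnormal
    have hle {m : ℕ} (hm : m ∣ Nat.card G) : m.primeFactors.card ≤ 2 :=
      (Finset.card_le_card (Nat.primeFactors_mono hm Nat.card_pos.ne')).trans h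
    have h1 : Group.IsSolvable N := ih _
      (lt_of_le_of_ne N.card_le_card_group fun h ↦ htop (Subgroup.eq_top_of_card_eq _ h)) N
      (hle N.card_subgroup_dvd_card) rfl
    have h2 : Group.IsSolvable (G ⧸ N) := ih _ (by
      rw [N.card_eq_card_quotient_mul_card_subgroup]
      exact lt_mul_of_one_lt_right Nat.card_pos (N.one_lt_card_iff_ne_bot.mpr hbot)) (G ⧸ N)
      (hle N.card_quotient_dvd_card) rfl
    exact Group.isSolvable_of_ker_le_range N.subtype (QuotientGroup.mk' N) (by simp)
  by_cases hcenter : Subgroup.center G = ⊤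
  · exact Group.isSolvable_of_comm fun x y ↦
      ((Subgroup.mem_center_iff.mp (hcenter ▸ Subgroup.mem_top x) y)).symm
  push Not at hnormal
  have hcenter' : Subgroup.center G = ⊥ := by
    by_contra hbot
    exact hcenter (hnormal _ inferInstance hbot)
  have : Nontrivial G := by
    by_contra hG
    rw [not_nontrivial_iff_subsingleton] at hG
    exact hcenter (Subsingleton.elim _ _)
  have : IsSimpleGroup G := ⟨fun N hN ↦ or_iff_not_imp_left.mpr (hnormal N hN)⟩
  obtain ⟨q, hq, hqG⟩ := Nat.exists_prime_and_dvd (Finite.one_lt_card (α := G)).ne'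
  have : Fact q.Prime := ⟨hq⟩
  obtain ⟨Q⟩ : Nonempty (Sylow q G) := inferInstance
  have : Nontrivial Q := by
    rw [← Finite.one_lt_card_iff_nontrivial]
    exact lt_of_lt_of_le hq.one_lt (Nat.le_of_dvd Nat.card_pos (Q.dvd_card_of_dvd_card hqG))
  have : Nontrivial (Subgroup.center Q) := Q.isPGroup'.center_nontrivial
  obtain ⟨⟨⟨g, hgQ⟩, hgc⟩, hg1⟩ := exists_ne (1 : Subgroup.center Q)
  have hg : g ≠ 1 := by
    rintro rfl
    exact hg1 rfl
  set c := Nat.card (ConjClasses.mk g).carrier with hc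
  have hcQ : c ∣ (Q : Subgroup G).index := by
    rw [hc, ← ConjAct.orbit_eq_carrier_conjClasses, Nat.card_coe_set_eq,
      ← MulAction.index_stabilizer, ← Subgroup.index_comap_of_surjective (Q : Subgroup G)
        (f := (ConjAct.ofConjAct : ConjAct G ≃* G).toMonoidHom) ConjAct.ofConjAct.surjective]
    refine Subgroup.index_dvd_of_le fun x hx ↦ ?_
    have h := congrArg Subtype.val
      (Subgroup.mem_center_iff.mp hgc ⟨ConjAct.ofConjAct x, hx⟩)
    rw [MulAction.mem_stabilizer_iff, ConjAct.smul_def, mul_inv_eq_iff_eq_mul]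
    exact h
  have hcG : c ∣ Nat.card G := hcQ.trans (Subgroup.index_dvd_card _)
  have hcq : ¬ q ∣ c := fun h ↦ Q.not_dvd_index (h.trans hcQ)
  by_cases hc1 : c = 1
  · exact absurd hc1 (IsSimpleGroup.card_conjClass_ne_prime_pow hcenter' hg hq 0)
  · have hcp := Nat.minFac_prime hc1
    refine absurd (Nat.eq_prime_pow_of_unique_prime_dvd (p := c.minFac)
      (ne_zero_of_dvd_ne_zero Nat.card_pos.ne' hcG) fun {r} hr hrc ↦ ?_)
      (IsSimpleGroup.card_conjClass_ne_prime_pow hcenter' hg hcp _)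
    by_contra hne
    have hsub : {q, c.minFac, r} ⊆ (Nat.card G).primeFactors := by
      intro s hs
      simp only [Finset.mem_insert, Finset.mem_singleton] at hs
      rw [Nat.mem_primeFactors_of_ne_zero Nat.card_pos.ne']
      rcases hs with rfl | rfl | rfl
      exacts [⟨hq, hqG⟩, ⟨hcp, c.minFac_dvd.trans hcG⟩, ⟨hr, hrc.trans hcG⟩]
    have hcard : ({q, c.minFac, r} : Finset ℕ).card = 3 :=
      Finset.card_eq_three.mpr ⟨q, c.minFac, r, fun h ↦ hcq (h ▸ c.minFac_dvd),
        fun h ↦ hcq (h ▸ hrc), Ne.symm hne, rfl⟩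
    have := Finset.card_le_card hsub
    lia

theorem two_primes_and_solvable_of_unique_noncentral_p_regular_class
    (G : Type*) [Group G] [Finite G] (p : ℕ) (hp : p.Prime) (hpG : p ∣ Nat.card G)
    (a : G) (ha₁ : ¬ p ∣ orderOf a) (ha₂ : a ∉ Subgroup.center G)
    (huniq : ∀ b : G, ¬ p ∣ orderOf b → b ∉ Subgroup.center G → IsConj a b) :
    (Nat.card G).primeFactors.card ≤ 2 ∧ IsSolvable G := by
  suffices h : (Nat.card G).primeFactors.card ≤ 2 from
    ⟨h, Group.isSolvable_of_card_primeFactors_le_two G h⟩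
  have horder (b : G) (hb₁ : ¬ p ∣ orderOf b) (hb₂ : b ∉ Subgroup.center G) :
      orderOf b = orderOf a := by
    obtain ⟨c, rfl⟩ := isConj_iff.mp (huniq b hb₁ hb₂)
    exact orderOf_injective (MulAut.conj c).toMonoidHom (MulAut.conj c).injective a
  have ha0 : 0 < orderOf a := orderOf_pos a
  have ha1 : orderOf a ≠ 1 := by
    rw [Ne, orderOf_eq_one_iff]
    rintro rfl
    exact ha₂ (one_mem _)
  /- Powers of `a` with prime exponent dividing the order of `a` are central. -/
  have hpow (r : ℕ) (hr : r.Prime) (hra : r ∣ orderOf a) : a ^ r ∈ Subgroup.center G := by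
    by_contra hc
    have hord : orderOf (a ^ r) = orderOf a / r := orderOf_pow_of_dvd hr.ne_zero hra
    have h := horder (a ^ r) (fun h ↦ ha₁ (h.trans (hord ▸ Nat.div_dvd_of_dvd hra))) hc
    exact (Nat.div_lt_self ha0 hr.one_lt).ne (hord.symm.trans h)
  set q := (orderOf a).minFac with hq_def
  have hq : q.Prime := Nat.minFac_prime ha1
  have hqa : q ∣ orderOf a := (orderOf a).minFac_dvd
  refine (Finset.card_le_card (t := {p, q}) fun r hr ↦ ?_).trans Finset.card_le_two
  have hrp := Nat.prime_of_mem_primeFactors hr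
  have hrG := Nat.dvd_of_mem_primeFactors hr
  by_contra hrpq
  simp only [Finset.mem_insert, Finset.mem_singleton, not_or] at hrpq
  by_cases hra : r ∣ orderOf a
  · obtain ⟨u, v, huv⟩ := Nat.isCoprime_iff_coprime.mpr
      ((Nat.coprime_primes hq hrp).mpr (Ne.symm hrpq.2))
    refine ha₂ ?_
    have h := mul_mem (zpow_mem (hpow q hq hqa) u) (zpow_mem (hpow r hrp hra) v)
    rwa [← zpow_natCast, ← zpow_natCast, ← zpow_mul, ← zpow_mul, ← zpow_add, mul_comm _ u,
      mul_comm _ v, huv, zpow_one] at h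
  · have : Fact r.Prime := ⟨hrp⟩
    obtain ⟨x, hx⟩ := exists_prime_orderOf_dvd_card' r hrG
    have hpr : ¬ p ∣ r := fun h ↦ hrpq.1 ((Nat.prime_dvd_prime_iff_eq hp hrp).mp h).symm
    by_cases hxc : x ∈ Subgroup.center G
    · have hord : orderOf (a * x) = orderOf a * r := by
        rw [Commute.orderOf_mul_eq_mul_orderOf_of_coprime
          (Subgroup.mem_center_iff.mp hxc a) (by
            rw [hx]
            exact ((Nat.Prime.coprime_iff_not_dvd hrp).mpr hra).symm), hx]
      have h := horder (a * x) (by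
        rw [hord, hp.dvd_mul]
        exact not_or.mpr ⟨ha₁, hpr⟩) fun h ↦ ha₂ ((Subgroup.mul_mem_cancel_right _ hxc).mp h)
      rw [hord] at h
      exact hrp.one_lt.ne' (Nat.eq_of_mul_eq_mul_left ha0 (h.trans (mul_one _).symm))
    · exact hra ((hx.symm.trans (horder x (hx ▸ hpr) hxc)).dvd)
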